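/- Let 1/2 ≤ ν < 1 and let m > 0 satisfy ∫₀^m M_ν(u) du = 1/2. Then for every t > 0, the median of the restriction of the Cauchy Green function to the positive half-line is located at x = m · t^ν, i.e. ∫₀^{m t^ν} G_c(r,t;ν) dr = 1/4 = (1/2) · ∫₀^∞ G_c(r,t;ν) dr. -/

import Mathlib

open Real MeasureTheory Set

/-- The Mainardi function `M_ν(x) = Σ_{n=0}^∞ (−x)^n/(n! · Γ(1 − ν − νn))`. -/
noncomputable def mainardi (ν x : ℝ) : ℝ :=
  ∑' n : ℕ, (-x) ^ n / ((n.factorial : ℝ) * Real.Gamma (1 - ν - ν * n))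

/-- The Green function of the Cauchy problem for the time-fractional
diffusion-wave equation: `G_c(x,t;ν) = M_ν(|x|/t^ν)/(2 t^ν)`. -/
noncomputable def greenCauchy (ν x t : ℝ) : ℝ :=
  mainardi ν (|x| / t ^ ν) / (2 * t ^ ν)

open Filter Topology

theorem norm_exp_neg_mul_exp_mul_I (ρ θ y : ℝ) :
    ‖Complex.exp (-(ρ * Complex.exp (θ * Complex.I) * y))‖ = Real.exp (-(ρ * cos θ) * y) := by
  rw [Complex.norm_exp]
  congr 1
  simp [Complex.exp_ofReal_mul_I_re, Complex.exp_ofReal_mul_I_im]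

theorem integrableOn_rpow_mul_cexp {q p ρ θ : ℝ} (hq : -1 < q) (hp : 0 < p) (hρ : 0 < ρ)
    (hθ : 0 < cos θ) :
    IntegrableOn (fun t : ℝ ↦ ((t ^ q : ℝ) : ℂ) *
      Complex.exp (-(ρ * Complex.exp (θ * Complex.I) * (t ^ p : ℝ)))) (Ioi 0) := by
  refine (integrableOn_rpow_mul_exp_neg_mul_rpow hq hp (mul_pos hρ hθ)).mono' ?_ ?_
  · exact Measurable.aestronglyMeasurable (by fun_prop)
  · refine (ae_restrict_iff' measurableSet_Ioi).2 (ae_of_all _ fun t ht ↦ ?_)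
    rw [norm_mul, norm_exp_neg_mul_exp_mul_I, Complex.norm_real,
      Real.norm_of_nonneg (rpow_nonneg (le_of_lt ht) _)]

theorem integral_deriv_rpow_mul_exp {s p ρ θ : ℝ} (hs : 0 < s) (hp : 0 < p) (hρ : 0 < ρ)
    (hθ : 0 < cos θ) :
    ∫ t in Ioi (0 : ℝ), (((s / p * t ^ (s - 1) : ℝ) : ℂ) -
      ρ * Complex.exp (θ * Complex.I) * (t ^ (s + p - 1) : ℝ)) *
        Complex.exp (-(ρ * Complex.exp (θ * Complex.I) * (t ^ p : ℝ))) = 0 := by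
  have hb : 0 < ρ * cos θ := mul_pos hρ hθ
  set w : ℂ := ρ * Complex.exp (θ * Complex.I) with hw
  have hnorm : ∀ y : ℝ, ‖Complex.exp (-(w * y))‖ = Real.exp (-(ρ * cos θ) * y) :=
    fun y ↦ norm_exp_neg_mul_exp_mul_I ρ θ y
  have hInt : ∀ q : ℝ, -1 < q → IntegrableOn (fun t : ℝ ↦ ((t ^ q : ℝ) : ℂ) *
      Complex.exp (-(w * (t ^ p : ℝ)))) (Ioi 0) :=
    fun q hq ↦ integrableOn_rpow_mul_cexp hq hp hρ hθ
  have key := integral_Ioi_of_hasDerivAt_of_tendsto (a := 0) (m := 0)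
    (f := fun t : ℝ ↦ (1 / p : ℂ) * (((t ^ s : ℝ) : ℂ) * Complex.exp (-(w * (t ^ p : ℝ)))))
    (f' := fun t : ℝ ↦ (((s / p * t ^ (s - 1) : ℝ) : ℂ) - w * (t ^ (s + p - 1) : ℝ)) *
        Complex.exp (-(w * (t ^ p : ℝ)))) ?_ ?_ ?_ ?_
  · rw [key]
    simp [Real.zero_rpow hs.ne']
  · have : Continuous fun t : ℝ ↦ t ^ p := Real.continuous_rpow_const hp.le
    have : Continuous fun t : ℝ ↦ t ^ s := Real.continuous_rpow_const hs.le
    refine Continuous.continuousWithinAt ?_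
    fun_prop
  · intro t ht
    have ht : 0 < t := ht
    have h1 := (Real.hasDerivAt_rpow_const (x := t) (p := s) (Or.inl ht.ne')).ofReal_comp
    have h2 := (Real.hasDerivAt_rpow_const (x := t) (p := p) (Or.inl ht.ne')).ofReal_comp
    have h3 := ((h1.mul (h2.const_mul w).neg.cexp).const_mul (1 / p : ℂ))
    refine h3.congr_deriv ?_
    have h4 : t ^ (s + p - 1) = t ^ s * t ^ (p - 1) := by
      rw [← rpow_add ht]; ring_nf
    have hp' : (p : ℂ) ≠ 0 := by exact_mod_cast hp.ne'
    simp only [Pi.neg_apply]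
    rw [h4]
    push_cast
    field_simp
    ring
  · have h1 := (hInt (s - 1) (by linarith)).const_mul ((s / p : ℝ) : ℂ)
    have h2 := (hInt (s + p - 1) (by linarith)).const_mul w
    refine (h1.sub h2).congr (ae_of_all _ fun t ↦ ?_)
    simp only [Pi.sub_apply]
    push_cast
    ring
  · have h := (tendsto_rpow_mul_exp_neg_mul_atTop_nhds_zero (s / p) _ hb).comp
      (tendsto_rpow_atTop hp)
    have h' : Tendsto (fun t : ℝ ↦ ((t ^ s : ℝ) : ℂ) * Complex.exp (-(w * (t ^ p : ℝ))))
        atTop (𝓝 0) := by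
      rw [tendsto_zero_iff_norm_tendsto_zero]
      refine h.congr' ?_
      filter_upwards [eventually_gt_atTop 0] with t ht
      rw [norm_mul, hnorm, Complex.norm_real, Real.norm_of_nonneg (rpow_nonneg (le_of_lt ht) _),
        Function.comp, ← rpow_mul ht.le]
      congr 2
      field_simp
    simpa using h'.const_mul (1 / p : ℂ)

theorem integral_rpow_mul_cexp {s p ρ θ : ℝ} (hs : 0 < s) (hp : 0 < p) (hρ : 0 < ρ)
    (hθ : θ ∈ Ioo (-(π / 2)) (π / 2)) :
    ∫ t in Ioi (0 : ℝ), ((t ^ (s - 1) : ℝ) : ℂ) *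
        Complex.exp (-(ρ * Complex.exp (θ * Complex.I) * (t ^ p : ℝ))) =
      Complex.exp (-((s / p * θ : ℝ) * Complex.I)) *
        ((ρ ^ (-s / p) * (1 / p) * Real.Gamma (s / p) : ℝ) : ℂ) := by
  set F : ℝ → ℝ → ℂ := fun θ t ↦ Complex.exp ((s / p * θ : ℝ) * Complex.I) *
    (((t ^ (s - 1) : ℝ) : ℂ) *
      Complex.exp (-(ρ * Complex.exp (θ * Complex.I) * (t ^ p : ℝ)))) with hF
  set F' : ℝ → ℝ → ℂ := fun θ t ↦ Complex.I * Complex.exp ((s / p * θ : ℝ) * Complex.I) *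
    ((((s / p * t ^ (s - 1) : ℝ) : ℂ) -
      ρ * Complex.exp (θ * Complex.I) * (t ^ (s + p - 1) : ℝ)) *
        Complex.exp (-(ρ * Complex.exp (θ * Complex.I) * (t ^ p : ℝ)))) with hF'
  have hderiv : ∀ θ ∈ Ioo (-(π / 2)) (π / 2),
      HasDerivAt (fun θ ↦ ∫ t in Ioi (0 : ℝ), F θ t) 0 θ := by
    intro θ hθ
    have hc := cos_pos_of_mem_Ioo hθ
    have hU : {y | cos θ / 2 < cos y} ∈ 𝓝 θ :=
      (isOpen_lt continuous_const continuous_cos).mem_nhds (by simp; linarith)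
    have hb : 0 < ρ * (cos θ / 2) := by positivity
    have h := hasDerivAt_integral_of_dominated_loc_of_deriv_le (μ := volume.restrict (Ioi 0))
      (F := F) (F' := F') (x₀ := θ)
      (bound := fun t ↦ s / p * (t ^ (s - 1) * Real.exp (-(ρ * (cos θ / 2)) * t ^ p)) +
        ρ * (t ^ (s + p - 1) * Real.exp (-(ρ * (cos θ / 2)) * t ^ p))) hU
      (Eventually.of_forall fun y ↦ ?_) ?_ ?_ ?_ ?_ ?_
    · refine h.2.congr_deriv ?_
      rw [hF', integral_const_mul, integral_deriv_rpow_mul_exp hs hp hρ hc, mul_zero]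
    · exact Measurable.aestronglyMeasurable (by fun_prop)
    · exact (integrableOn_rpow_mul_cexp (by linarith) hp hρ hc).const_mul _
    · exact Measurable.aestronglyMeasurable (by fun_prop)
    · refine (ae_restrict_iff' measurableSet_Ioi).2 (ae_of_all _ fun t ht y hy ↦ ?_)
      have ht : 0 < t := ht
      have hy : cos θ / 2 < cos y := hy
      simp only [hF']
      rw [norm_mul, norm_mul, norm_mul, Complex.norm_I, Complex.norm_exp_ofReal_mul_I,
        norm_exp_neg_mul_exp_mul_I, one_mul, one_mul]
      have h1 : Real.exp (-(ρ * cos y) * t ^ p) ≤ Real.exp (-(ρ * (cos θ / 2)) * t ^ p) := by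
        gcongr
      have h2 : ‖((s / p * t ^ (s - 1) : ℝ) : ℂ) -
          ρ * Complex.exp (y * Complex.I) * (t ^ (s + p - 1) : ℝ)‖ ≤
          s / p * t ^ (s - 1) + ρ * t ^ (s + p - 1) := by
        refine (norm_sub_le _ _).trans (le_of_eq ?_)
        rw [norm_mul, norm_mul, Complex.norm_exp_ofReal_mul_I, Complex.norm_real,
          Complex.norm_real, Complex.norm_real, Real.norm_of_nonneg (by positivity),
          Real.norm_of_nonneg hρ.le, Real.norm_of_nonneg (by positivity), mul_one]
      calc _ ≤ (s / p * t ^ (s - 1) + ρ * t ^ (s + p - 1)) *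
            Real.exp (-(ρ * (cos θ / 2)) * t ^ p) := by gcongr
        _ = _ := by ring
    · exact ((integrableOn_rpow_mul_exp_neg_mul_rpow (by linarith) hp hb).const_mul _).add
        ((integrableOn_rpow_mul_exp_neg_mul_rpow (by linarith) hp hb).const_mul _)
    · refine (ae_restrict_iff' measurableSet_Ioi).2 (ae_of_all _ fun t ht y hy ↦ ?_)
      have ht : 0 < t := ht
      have h0 : HasDerivAt (fun y : ℝ ↦ (y : ℂ)) 1 y := Complex.ofRealCLM.hasDerivAt
      have h1 := ((h0.const_mul ((s / p : ℝ) : ℂ)).mul_const Complex.I).cexp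
      have h2 := ((((h0.mul_const Complex.I).cexp.const_mul (ρ : ℂ)).mul_const
        ((t ^ p : ℝ) : ℂ)).neg).cexp
      have h3 := h1.mul (h2.const_mul ((t ^ (s - 1) : ℝ) : ℂ))
      have h4 : t ^ (s + p - 1) = t ^ (s - 1) * t ^ p := by
        rw [← rpow_add ht]; ring_nf
      simp only [hF, hF', Complex.ofReal_mul (s / p)]
      refine h3.congr_deriv ?_
      simp only [Pi.neg_apply]
      rw [h4]
      push_cast
      ring
  have hconst : (∫ t in Ioi (0 : ℝ), F θ t) = ∫ t in Ioi (0 : ℝ), F 0 t :=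
    isOpen_Ioo.is_const_of_deriv_eq_zero isPreconnected_Ioo
      (fun y hy ↦ (hderiv y hy).differentiableAt.differentiableWithinAt)
      (fun y hy ↦ (hderiv y hy).deriv) hθ ⟨by linarith [pi_pos], by linarith [pi_pos]⟩
  have h0 : (∫ t in Ioi (0 : ℝ), F 0 t) =
      ((ρ ^ (-s / p) * (1 / p) * Real.Gamma (s / p) : ℝ) : ℂ) := by
    have := integral_rpow_mul_exp_neg_mul_rpow hp (show -1 < s - 1 by linarith) hρ
    rw [sub_add_cancel] at this
    rw [← this, ← integral_complex_ofReal]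
    refine integral_congr_ae (ae_of_all _ fun t ↦ ?_)
    simp [hF]
  rw [h0, hF, integral_const_mul] at hconst
  rw [← hconst, ← mul_assoc, ← Complex.exp_add, neg_add_cancel, Complex.exp_zero, one_mul]

theorem inv_Gamma_one_sub {s : ℝ} (hs : 0 < s) :
    (Real.Gamma (1 - s))⁻¹ = sin (π * s) * Real.Gamma s / π := by
  have hG := (Real.Gamma_pos_of_pos hs).ne'
  have h := Real.Gamma_mul_Gamma_one_sub s
  have h' : Real.Gamma (1 - s) = π / sin (π * s) / Real.Gamma s := by
    rw [← h]
    field_simp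
  rw [h', inv_div, div_div_eq_mul_div, mul_comm]

theorem abs_inv_Gamma_one_sub_le {s : ℝ} (hs : 0 ≤ s) :
    |(Real.Gamma (1 - s))⁻¹| ≤ Real.Gamma (1 + s) := by
  rcases hs.eq_or_lt with rfl | hs
  · simp
  · have hG := Real.Gamma_pos_of_pos hs
    rw [inv_Gamma_one_sub hs, add_comm, Real.Gamma_add_one hs.ne', abs_div, abs_mul,
      abs_of_pos hG, abs_of_pos pi_pos, div_le_iff₀ pi_pos]
    have : |sin (π * s)| ≤ π * s := abs_sin_le_abs.trans_eq (abs_of_pos (by positivity))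
    nlinarith

theorem Gamma_add_le_rpow_mul {y ν : ℝ} (hy : 0 < y) (hν0 : 0 < ν) (hν1 : ν < 1) :
    Real.Gamma (y + ν) ≤ y ^ ν * Real.Gamma y := by
  have hG := Real.Gamma_pos_of_pos hy
  have h := Real.Gamma_mul_add_mul_le_rpow_Gamma_mul_rpow_Gamma hy
    (show 0 < y + 1 by linarith) (show 0 < 1 - ν by linarith) hν0 (by ring)
  rw [Real.Gamma_add_one hy.ne', mul_rpow hy.le hG.le, mul_left_comm, ← rpow_add hG,
    sub_add_cancel, rpow_one] at h
  convert h using 2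
  ring

theorem summable_pow_div_factorial_mul_Gamma {ν a : ℝ} (hν0 : 0 < ν) (hν1 : ν < 1) (ha : 0 < a)
    (x : ℝ) : Summable fun n : ℕ ↦ x ^ n / n.factorial * Real.Gamma (a + ν * n) := by
  have hlim : Tendsto (fun n : ℕ ↦ |x| * (a + 1) ^ ν * ((n : ℝ) + 1) ^ (-(1 - ν))) atTop (𝓝 0) := by
    have := ((tendsto_rpow_neg_atTop (show 0 < 1 - ν by linarith)).comp
      (tendsto_atTop_add_const_right _ (1 : ℝ) tendsto_natCast_atTop_atTop)).const_mul
        (|x| * (a + 1) ^ ν)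
    simpa using this
  refine summable_of_ratio_norm_eventually_le (r := 1 / 2) (by norm_num) ?_
  filter_upwards [hlim.eventually_le_const (show (0 : ℝ) < 1 / 2 by norm_num)] with n hn
  have hy : 0 < a + ν * n := by positivity
  have hG := Real.Gamma_pos_of_pos hy
  have hG' : 0 < Real.Gamma (a + ν * (n + 1 : ℕ)) := Real.Gamma_pos_of_pos (by positivity)
  have h1 : Real.Gamma (a + ν * (n + 1 : ℕ)) ≤ (a + ν * n) ^ ν * Real.Gamma (a + ν * n) := by
    convert Gamma_add_le_rpow_mul hy hν0 hν1 using 2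
    push_cast
    ring
  have h2 : (a + ν * n) ^ ν ≤ (a + 1) ^ ν * ((n : ℝ) + 1) ^ ν := by
    rw [← mul_rpow (by positivity) (by positivity)]
    gcongr
    nlinarith [mul_nonneg ha.le (Nat.cast_nonneg (α := ℝ) n), Nat.cast_nonneg (α := ℝ) n]
  have h3 : ((n : ℝ) + 1) ^ (-(1 - ν)) = ((n : ℝ) + 1) ^ ν / (n + 1) := by
    rw [neg_sub, rpow_sub_one (by positivity)]
  rw [norm_mul, norm_mul, norm_div, norm_div, norm_pow, norm_pow, Real.norm_of_nonneg hG.le,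
    Real.norm_of_nonneg hG'.le, Real.norm_natCast, Real.norm_natCast, Real.norm_eq_abs,
    Nat.factorial_succ]
  calc |x| ^ (n + 1) / ((n + 1) * n.factorial : ℕ) * Real.Gamma (a + ν * (n + 1 : ℕ))
      ≤ |x| ^ (n + 1) / ((n + 1) * n.factorial : ℕ) *
        ((a + 1) ^ ν * ((n : ℝ) + 1) ^ ν * Real.Gamma (a + ν * n)) := by
        gcongr
        exact h1.trans (by gcongr)
    _ = |x| * (a + 1) ^ ν * ((n : ℝ) + 1) ^ (-(1 - ν)) *
        (|x| ^ n / n.factorial * Real.Gamma (a + ν * n)) := by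
        rw [h3]
        push_cast
        field_simp
        ring
    _ ≤ _ := by gcongr

/-- The Wright-type series `Σ (-x)^n / (n! Γ(1 - δ - νn))`, which is the Mainardi function
for `δ = ν`. -/
noncomputable def mainardiSeries (ν δ x : ℝ) : ℝ :=
  ∑' n : ℕ, (-x) ^ n / ((n.factorial : ℝ) * Real.Gamma (1 - δ - ν * n))

theorem norm_mainardiSeries_term_le {ν δ : ℝ} (hν0 : 0 < ν) (hδ : 0 ≤ δ) (x : ℝ) (n : ℕ) :
    ‖(-x) ^ n / ((n.factorial : ℝ) * Real.Gamma (1 - δ - ν * n))‖ ≤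
      |x| ^ n / n.factorial * Real.Gamma (1 + δ + ν * n) := by
  have h := abs_inv_Gamma_one_sub_le (show 0 ≤ δ + ν * n by positivity)
  rw [← sub_sub, ← add_assoc] at h
  rw [← div_div, div_eq_mul_inv _ (Real.Gamma _), norm_mul, norm_div, norm_pow, norm_neg,
    Real.norm_natCast, Real.norm_eq_abs, Real.norm_eq_abs]
  gcongr

theorem summable_mainardiSeries {ν δ : ℝ} (hν0 : 0 < ν) (hν1 : ν < 1) (hδ : 0 ≤ δ) (x : ℝ) :
    Summable fun n : ℕ ↦ (-x) ^ n / ((n.factorial : ℝ) * Real.Gamma (1 - δ - ν * n)) :=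
  .of_norm_bounded
    (summable_pow_div_factorial_mul_Gamma hν0 hν1 (by linarith) |x|)
    (norm_mainardiSeries_term_le hν0 hδ x)

theorem hasDerivAt_mainardiSeries {ν δ : ℝ} (hν0 : 0 < ν) (hν1 : ν < 1) (hδ : 0 ≤ δ) (x : ℝ) :
    HasDerivAt (mainardiSeries ν δ) (-mainardiSeries ν (δ + ν) x) x := by
  set R := |x| + 1
  set g' : ℕ → ℝ → ℝ := fun n y ↦
    (n * (-y) ^ (n - 1) * -1) / ((n.factorial : ℝ) * Real.Gamma (1 - δ - ν * n)) with hg'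
  have hsucc : ∀ n y, g' (n + 1) y =
      -((-y) ^ n / ((n.factorial : ℝ) * Real.Gamma (1 - (δ + ν) - ν * n))) := by
    intro n y
    have : 1 - δ - ν * ((n : ℝ) + 1) = 1 - (δ + ν) - ν * n := by ring
    simp only [hg', Nat.factorial_succ, Nat.add_sub_cancel]
    push_cast
    rw [this, mul_assoc, mul_assoc, mul_div_mul_left _ _ (by positivity)]
    ring
  have hbound : Summable fun n : ℕ ↦ (if n = 0 then 0 else
      R ^ (n - 1) / (n - 1).factorial * Real.Gamma (1 + (δ + ν) + ν * (n - 1 : ℕ))) := by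
    rw [← summable_nat_add_iff 1]
    simpa using summable_pow_div_factorial_mul_Gamma hν0 hν1
      (show 0 < 1 + (δ + ν) by positivity) R
  have h := hasDerivAt_tsum_of_isPreconnected hbound (isOpen_Ioo (a := -R) (b := R))
    isPreconnected_Ioo (g := fun (n : ℕ) y ↦
      (-y) ^ n / ((n.factorial : ℝ) * Real.Gamma (1 - δ - ν * n))) (g' := g') (y₀ := x) (y := x)
    ?_ ?_ ?_ (summable_mainardiSeries hν0 hν1 hδ x) ?_
  · refine h.congr_deriv ?_
    have hs : Summable fun n ↦ g' n x := by
      rw [← summable_nat_add_iff 1]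
      simp only [hsucc]
      exact (summable_mainardiSeries hν0 hν1 (by positivity) x).neg
    rw [hs.tsum_eq_zero_add]
    simp only [hsucc, tsum_neg, mainardiSeries]
    simp [hg']
  · intro n y _
    exact ((hasDerivAt_neg y).pow n).div_const _
  · rintro (_ | n) y hy
    · simp [hg']
    · rw [hsucc, norm_neg]
      refine (norm_mainardiSeries_term_le hν0 (by positivity) y n).trans ?_
      simp only [Nat.add_sub_cancel, Nat.add_eq_zero_iff, one_ne_zero, and_false, if_false]
      have := (Real.Gamma_pos_of_pos (show 0 < 1 + (δ + ν) + ν * n by positivity)).le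
      gcongr
      exact (abs_lt.2 hy).le
  all_goals exact abs_lt.1 (lt_add_one |x|)

theorem continuous_inv_Gamma : Continuous fun s : ℝ ↦ (Real.Gamma s)⁻¹ := by
  have h := Complex.continuous_re.comp
    (Complex.differentiable_one_div_Gamma.continuous.comp Complex.continuous_ofReal)
  refine h.congr fun s ↦ ?_
  simp [Complex.Gamma_ofReal, ← Complex.ofReal_inv]

theorem tendsto_mainardiSeries {ν : ℝ} (hν0 : 0 < ν) (hν1 : ν < 1) (x : ℝ) :
    Tendsto (fun δ ↦ mainardiSeries ν δ x) (𝓝[>] 0) (𝓝 (mainardiSeries ν 0 x)) := by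
  have hs1 := summable_pow_div_factorial_mul_Gamma hν0 hν1 one_pos |x|
  have hs2 := summable_pow_div_factorial_mul_Gamma hν0 hν1 two_pos |x|
  refine tendsto_tsum_of_dominated_convergence (hs1.add hs2) (fun n ↦ ?_) ?_
  · simp only [← div_div, div_eq_mul_inv _ (Real.Gamma _)]
    refine Tendsto.const_mul _ (Tendsto.mono_left ?_ nhdsWithin_le_nhds)
    exact (continuous_inv_Gamma.comp (by fun_prop : Continuous fun δ ↦ 1 - δ - ν * n)).tendsto 0
  · filter_upwards [Ioo_mem_nhdsGT (zero_lt_one (α := ℝ))] with δ hδ n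
    refine (norm_mainardiSeries_term_le hν0 hδ.1.le x n).trans ?_
    have h1 := Real.Gamma_pos_of_pos (show 0 < 1 + ν * n by positivity)
    have h2 := Real.Gamma_pos_of_pos (show 0 < 2 + ν * n by positivity)
    have h := (Real.convexOn_Gamma.le_max_of_mem_Icc (x := 1 + ν * n) (y := 2 + ν * n)
      (z := 1 + δ + ν * n) (mem_Ioi.2 (by positivity)) (mem_Ioi.2 (by positivity))
      ⟨by linarith [hδ.1], by linarith [hδ.2]⟩).trans (max_le_add_of_nonneg h1.le h2.le)
    rw [← mul_add]
    gcongr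

theorem norm_cexp_sub_one_le {z : ℂ} (hz : z.re ≤ 0) : ‖Complex.exp z - 1‖ ≤ 2 * ‖z‖ := by
  rcases le_total ‖z‖ 1 with h | h
  · exact Complex.norm_exp_sub_one_le h
  · have h1 : ‖Complex.exp z‖ ≤ 1 := by
      rw [Complex.norm_exp]
      exact Real.exp_le_one_iff.2 hz
    have h2 := norm_sub_le (Complex.exp z) 1
    rw [norm_one] at h2
    linarith

/-- The Wright series as the imaginary part of an integral along the ray of argument `φ`, where
`π / 2 < φ < π`: the Hankel contour integral for `1 / Γ`, collapsed onto two conjugate rays. -/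
theorem mainardiSeries_eq_im_integral {ν δ x φ : ℝ} (hν0 : 0 < ν) (hν1 : ν < 1) (hδ : 0 < δ)
    (hφ : φ ∈ Ioo (π / 2) π) :
    π * mainardiSeries ν δ x = (∫ r in Ioi (0 : ℝ), Complex.exp ((φ * δ : ℝ) * Complex.I) *
      (((r ^ (δ - 1) : ℝ) : ℂ) *
        Complex.exp (-(x * Complex.exp ((ν * φ : ℝ) * Complex.I) * (r ^ ν : ℝ)))) *
      Complex.exp (-((1 : ℝ) * Complex.exp ((φ - π : ℝ) * Complex.I) * (r ^ (1 : ℝ) : ℝ)))).im := by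
  have hθ : φ - π ∈ Ioo (-(π / 2)) (π / 2) := ⟨by linarith [hφ.1], by linarith [hφ.2, pi_pos]⟩
  have hc : 0 < cos (φ - π) := cos_pos_of_mem_Ioo hθ
  set c := cos (φ - π)
  have hs : ∀ n : ℕ, 0 < δ + ν * n := fun n ↦ by positivity
  set k : ℕ → ℂ := fun n ↦
    (((-x) ^ n / n.factorial : ℝ) : ℂ) * Complex.exp ((φ * (δ + ν * n) : ℝ) * Complex.I) with hk
  set F : ℕ → ℝ → ℂ := fun n r ↦ k n * (((r ^ (δ + ν * n - 1) : ℝ) : ℂ) *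
    Complex.exp (-((1 : ℝ) * Complex.exp ((φ - π : ℝ) * Complex.I) * (r ^ (1 : ℝ) : ℝ)))) with hF
  have hkn : ∀ n, ‖k n‖ = |x| ^ n / n.factorial := fun n ↦ by
    rw [hk, norm_mul, Complex.norm_exp_ofReal_mul_I, Complex.norm_real, norm_div, norm_pow,
      norm_neg, Real.norm_natCast, Real.norm_eq_abs, mul_one]
  have hFint : ∀ n, IntegrableOn (F n) (Ioi 0) := fun n ↦
    (integrableOn_rpow_mul_cexp (by linarith [hs n]) one_pos one_pos hc).const_mul _
  have hFnorm : ∀ n, ∫ r in Ioi (0 : ℝ), ‖F n r‖ =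
      c ^ (-δ) * ((|x| * c ^ (-ν)) ^ n / n.factorial * Real.Gamma (δ + ν * n)) := by
    intro n
    have h1 := integral_rpow_mul_exp_neg_mul_rpow one_pos
      (show -1 < δ + ν * n - 1 by linarith [hs n]) hc
    have h2 : ∫ r in Ioi (0 : ℝ), ‖F n r‖ = ∫ r in Ioi (0 : ℝ), |x| ^ n / n.factorial *
        (r ^ (δ + ν * n - 1) * Real.exp (-c * r ^ (1 : ℝ))) := by
      refine setIntegral_congr_fun measurableSet_Ioi fun r hr ↦ ?_
      simp only [hF]
      rw [norm_mul, hkn, norm_mul, norm_exp_neg_mul_exp_mul_I, Complex.norm_real,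
        Real.norm_of_nonneg (rpow_nonneg (le_of_lt hr) _), one_mul]
    have h3 : c ^ (-(δ + ν * n)) = c ^ (-δ) * (c ^ (-ν)) ^ n := by
      rw [← rpow_natCast, ← rpow_mul hc.le, ← rpow_add hc]
      ring_nf
    rw [h2, integral_const_mul, h1, sub_add_cancel, div_one, div_one, h3, mul_pow]
    ring_nf
  have hsum := hasSum_integral_of_summable_integral_norm hFint (by
    simp only [hFnorm]
    exact (summable_pow_div_factorial_mul_Gamma hν0 hν1 hδ _).mul_left _)
  have hInt : ∀ n, (∫ r in Ioi (0 : ℝ), F n r).im =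
      π * ((-x) ^ n / ((n.factorial : ℝ) * Real.Gamma (1 - δ - ν * n))) := by
    intro n
    have h1 : ∫ r in Ioi (0 : ℝ), F n r =
        (((-x) ^ n / n.factorial * Real.Gamma (δ + ν * n) : ℝ) : ℂ) *
          Complex.exp ((π * (δ + ν * n) : ℝ) * Complex.I) := by
      have h2 : Complex.exp ((π * (δ + ν * n) : ℝ) * Complex.I) =
          Complex.exp ((φ * (δ + ν * n) : ℝ) * Complex.I) *
            Complex.exp (-(((δ + ν * n) / 1 * (φ - π) : ℝ) * Complex.I)) := by
        rw [← Complex.exp_add]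
        congr 1
        push_cast
        ring
      simp only [hF, hk]
      rw [integral_const_mul, integral_rpow_mul_cexp (hs n) one_pos one_pos hθ, h2]
      simp only [one_rpow, div_one, one_mul]
      push_cast
      ring
    rw [h1, Complex.im_ofReal_mul, Complex.exp_ofReal_mul_I_im, ← div_div,
      div_eq_mul_inv _ (Real.Gamma _), sub_sub, inv_Gamma_one_sub (hs n)]
    field_simp
  have him := (Complex.hasSum_im hsum).tsum_eq
  simp only [hInt, tsum_mul_left] at him
  rw [mainardiSeries, him]
  congr 1
  refine setIntegral_congr_fun measurableSet_Ioi fun r hr ↦ ?_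
  have hr : 0 < r := hr
  have hterm : ∀ n, F n r = Complex.exp ((φ * δ : ℝ) * Complex.I) * ((r ^ (δ - 1) : ℝ) : ℂ) *
      Complex.exp (-((1 : ℝ) * Complex.exp ((φ - π : ℝ) * Complex.I) * (r ^ (1 : ℝ) : ℝ))) *
      ((-(x * Complex.exp ((ν * φ : ℝ) * Complex.I) * (r ^ ν : ℝ))) ^ n / n.factorial) := by
    intro n
    have h1 : r ^ (δ + ν * n - 1) = r ^ (δ - 1) * (r ^ ν) ^ n := by
      rw [← rpow_natCast, ← rpow_mul hr.le, ← rpow_add hr]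
      ring_nf
    have h2 : Complex.exp ((φ * (δ + ν * n) : ℝ) * Complex.I) =
        Complex.exp ((φ * δ : ℝ) * Complex.I) * Complex.exp ((ν * φ : ℝ) * Complex.I) ^ n := by
      rw [← Complex.exp_nat_mul, ← Complex.exp_add]
      congr 1
      push_cast
      ring
    simp only [hF, hk]
    rw [h1, h2, ← neg_mul _ ((r ^ ν : ℝ) : ℂ), ← neg_mul (x : ℂ), mul_pow, mul_pow]
    push_cast
    ring
  simp only [hterm]
  rw [tsum_mul_left, (NormedSpace.expSeries_div_hasSum_exp
    (-(x * Complex.exp ((ν * φ : ℝ) * Complex.I) * (r ^ ν : ℝ)) : ℂ)).tsum_eq,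
    ← Complex.exp_eq_exp_ℂ]
  ring

theorem abs_mainardiSeries_le {ν δ x φ : ℝ} (hν0 : 0 < ν) (hν1 : ν < 1) (hδ : 0 < δ) (hx : 0 < x)
    (hφ : φ ∈ Ioo (π / 2) π) (hνφ : ν * φ < π / 2) :
    |mainardiSeries ν δ x| ≤
      2 / π * ((x * cos (ν * φ)) ^ (-(δ + 1) / ν) * (1 / ν) * Real.Gamma ((δ + 1) / ν)) := by
  have hνφ' : ν * φ ∈ Ioo (-(π / 2)) (π / 2) :=
    ⟨by nlinarith [hφ.1, pi_pos], hνφ⟩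
  have hd : 0 < cos (ν * φ) := cos_pos_of_mem_Ioo hνφ'
  have hθ : 0 < cos (φ - π) :=
    cos_pos_of_mem_Ioo ⟨by linarith [hφ.1], by linarith [hφ.2, pi_pos]⟩
  set A : ℝ → ℂ := fun r ↦ Complex.exp ((φ * δ : ℝ) * Complex.I) * (((r ^ (δ - 1) : ℝ) : ℂ) *
    Complex.exp (-(x * Complex.exp ((ν * φ : ℝ) * Complex.I) * (r ^ ν : ℝ)))) with hA
  set B : ℝ → ℂ := fun r ↦
    Complex.exp (-((1 : ℝ) * Complex.exp ((φ - π : ℝ) * Complex.I) * (r ^ (1 : ℝ) : ℝ))) with hB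
  have hAint : IntegrableOn A (Ioi 0) :=
    (integrableOn_rpow_mul_cexp (by linarith) hν0 hx hd).const_mul _
  have hAim : (∫ r in Ioi (0 : ℝ), A r).im = 0 := by
    have : (φ * δ : ℝ) * Complex.I + -((δ / ν * (ν * φ) : ℝ) * Complex.I) = 0 := by
      have : δ / ν * (ν * φ) = φ * δ := by field_simp
      rw [this, add_neg_cancel]
    rw [hA, integral_const_mul, integral_rpow_mul_cexp hδ hν0 hx hνφ', ← mul_assoc,
      ← Complex.exp_add, this, Complex.exp_zero, one_mul, Complex.ofReal_im]
  have hBle : ∀ r ∈ Ioi (0 : ℝ), ‖B r‖ ≤ 1 := by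
    intro r hr
    have hr : 0 < r := hr
    rw [hB, norm_exp_neg_mul_exp_mul_I, Real.exp_le_one_iff, one_mul, neg_mul]
    exact neg_nonpos.2 (by positivity)
  have hABint : IntegrableOn (fun r ↦ A r * B r) (Ioi 0) := by
    refine hAint.norm.mono' (Measurable.aestronglyMeasurable (by fun_prop)) ?_
    refine (ae_restrict_iff' measurableSet_Ioi).2 (ae_of_all _ fun r hr ↦ ?_)
    rw [norm_mul]
    exact mul_le_of_le_one_right (norm_nonneg _) (hBle r hr)
  have hrep : π * mainardiSeries ν δ x = (∫ r in Ioi (0 : ℝ), (A r * B r - A r)).im := by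
    rw [integral_sub hABint hAint, Complex.sub_im, hAim, sub_zero]
    exact mainardiSeries_eq_im_integral hν0 hν1 hδ hφ
  have hxd : 0 < x * cos (ν * φ) := mul_pos hx hd
  have hbound : ‖∫ r in Ioi (0 : ℝ), (A r * B r - A r)‖ ≤
      ∫ r in Ioi (0 : ℝ), 2 * (r ^ δ * Real.exp (-(x * cos (ν * φ)) * r ^ ν)) := by
    refine norm_integral_le_of_norm_le
      ((integrableOn_rpow_mul_exp_neg_mul_rpow (by linarith) hν0 hxd).const_mul _) ?_
    refine (ae_restrict_iff' measurableSet_Ioi).2 (ae_of_all _ fun r hr ↦ ?_)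
    have hr : 0 < r := hr
    have h1 : ‖B r - 1‖ ≤ 2 * r := by
      refine (norm_cexp_sub_one_le ?_).trans_eq ?_
      · rw [rpow_one, Complex.neg_re, mul_assoc, Complex.re_ofReal_mul, Complex.re_mul_ofReal,
          Complex.exp_ofReal_mul_I_re]
        exact neg_nonpos.2 (by positivity)
      · rw [norm_neg, norm_mul, norm_mul, Complex.norm_exp_ofReal_mul_I, Complex.norm_real,
          Complex.norm_real, norm_one, rpow_one, Real.norm_of_nonneg hr.le, one_mul, one_mul]
    have h2 : ‖A r‖ = r ^ (δ - 1) * Real.exp (-(x * cos (ν * φ)) * r ^ ν) := by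
      rw [hA, norm_mul, norm_mul, Complex.norm_exp_ofReal_mul_I, norm_exp_neg_mul_exp_mul_I,
        Complex.norm_real, Real.norm_of_nonneg (rpow_nonneg hr.le _), one_mul]
    rw [← mul_sub_one, norm_mul, h2]
    calc _ ≤ r ^ (δ - 1) * Real.exp (-(x * cos (ν * φ)) * r ^ ν) * (2 * r) := by gcongr
      _ = _ := by
        rw [rpow_sub_one hr.ne']
        field_simp
  rw [integral_const_mul, integral_rpow_mul_exp_neg_mul_rpow hν0 (by linarith) hxd] at hbound
  have h := (Complex.abs_im_le_norm _).trans hbound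
  rw [← hrep, abs_mul, abs_of_pos pi_pos] at h
  rw [div_mul_eq_mul_div, le_div_iff₀ pi_pos]
  linarith

theorem exists_contour_angle {ν : ℝ} (hν0 : 1 / 2 ≤ ν) (hν1 : ν < 1) :
    ∃ φ ∈ Ioo (π / 2) π, ν * φ < π / 2 := by
  have hπ := pi_pos
  have hν : 0 < ν := by linarith
  refine ⟨(π / 2 + π / (2 * ν)) / 2, ⟨?_, ?_⟩, ?_⟩
  · have : π / 2 < π / (2 * ν) := by gcongr; linarith
    linarith
  · have : π / (2 * ν) ≤ π := div_le_self hπ.le (by linarith)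
    linarith
  · have : ν * (π / (2 * ν)) = π / 2 := by field_simp
    nlinarith

theorem tendsto_mainardiSeries_zero_atTop {ν : ℝ} (hν0 : 1 / 2 ≤ ν) (hν1 : ν < 1) :
    Tendsto (mainardiSeries ν 0) atTop (𝓝 0) := by
  obtain ⟨φ, hφ, hνφ⟩ := exists_contour_angle hν0 hν1
  have hν : 0 < ν := by linarith
  have hd : 0 < cos (ν * φ) := cos_pos_of_mem_Ioo ⟨by nlinarith [hφ.1, pi_pos], hνφ⟩
  have hle : ∀ x, 0 < x → |mainardiSeries ν 0 x| ≤
      2 / π * ((x * cos (ν * φ)) ^ (-(0 + 1) / ν) * (1 / ν) * Real.Gamma ((0 + 1) / ν)) := by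
    intro x hx
    have hxd : 0 < x * cos (ν * φ) := mul_pos hx hd
    have hG : ContinuousAt (fun δ ↦ Real.Gamma ((δ + 1) / ν)) 0 := by
      refine ContinuousAt.comp (g := Real.Gamma) (f := fun δ ↦ (δ + 1) / ν) ?_ (by fun_prop)
      refine (Real.differentiableAt_Gamma fun k ↦ ?_).continuousAt
      have : 0 < (0 + 1) / ν := by positivity
      have : (0 : ℝ) ≤ k := k.cast_nonneg
      linarith
    have hr : ContinuousAt (fun δ ↦ (x * cos (ν * φ)) ^ (-(δ + 1) / ν)) 0 :=
      ContinuousAt.rpow continuousAt_const (by fun_prop) (Or.inl hxd.ne')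
    refine le_of_tendsto_of_tendsto (tendsto_mainardiSeries hν hν1 x).abs
      ((((hr.mul_const _).mul hG).const_mul (2 / π)).tendsto.mono_left nhdsWithin_le_nhds) ?_
    filter_upwards [self_mem_nhdsWithin] with δ hδ
    exact abs_mainardiSeries_le hν hν1 hδ hx hφ hνφ
  refine squeeze_zero_norm' (eventually_atTop.2 ⟨1, fun x hx ↦ hle x (by linarith)⟩) ?_
  have h := (tendsto_rpow_neg_atTop (show 0 < 1 / ν by positivity)).comp
    (tendsto_id.atTop_mul_const hd)
  have h' := ((h.mul_const (1 / ν)).mul_const (Real.Gamma ((0 + 1) / ν))).const_mul (2 / π)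
  simpa [neg_div, Function.comp_def] using h'

theorem mainardi_eq_mainardiSeries (ν : ℝ) : mainardi ν = mainardiSeries ν ν := rfl

theorem continuous_mainardi {ν : ℝ} (hν0 : 0 < ν) (hν1 : ν < 1) : Continuous (mainardi ν) :=
  continuous_iff_continuousAt.2 fun x ↦ (hasDerivAt_mainardiSeries hν0 hν1 hν0.le x).continuousAt

theorem integrableOn_mainardi {ν : ℝ} (hν0 : 1 / 2 ≤ ν) (hν1 : ν < 1) :
    IntegrableOn (mainardi ν) (Ioi 0) := by
  obtain ⟨φ, hφ, hνφ⟩ := exists_contour_angle hν0 hν1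
  have hν : 0 < ν := by linarith
  have hd : 0 < cos (ν * φ) := cos_pos_of_mem_Ioo ⟨by nlinarith [hφ.1, pi_pos], hνφ⟩
  have hcont := continuous_mainardi hν hν1
  rw [← Ioc_union_Ioi_eq_Ioi zero_le_one]
  refine (hcont.integrableOn_Ioc).union ?_
  have hexp : -(ν + 1) / ν < -1 := by
    rw [div_lt_iff₀ hν]
    linarith
  refine ((integrableOn_Ioi_rpow_of_lt hexp one_pos).const_mul (2 / π *
    (cos (ν * φ) ^ (-(ν + 1) / ν) * (1 / ν) * Real.Gamma ((ν + 1) / ν)))).mono'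
    hcont.aestronglyMeasurable ?_
  refine (ae_restrict_iff' measurableSet_Ioi).2 (ae_of_all _ fun x hx ↦ ?_)
  have hx : 0 < x := one_pos.trans hx
  refine (abs_mainardiSeries_le hν hν1 hν hx hφ hνφ).trans_eq ?_
  rw [mul_rpow hx.le hd.le]
  ring

theorem integral_mainardi {ν : ℝ} (hν0 : 1 / 2 ≤ ν) (hν1 : ν < 1) :
    ∫ x in Ioi (0 : ℝ), mainardi ν x = 1 := by
  have hν : 0 < ν := by linarith
  have hderiv : ∀ x, HasDerivAt (fun x ↦ -mainardiSeries ν 0 x) (mainardi ν x) x :=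
    fun x ↦ (hasDerivAt_mainardiSeries hν hν1 le_rfl x).neg.congr_deriv
      (by rw [neg_neg, zero_add, mainardi_eq_mainardiSeries])
  have hzero : mainardiSeries ν 0 0 = 1 := by
    rw [mainardiSeries, tsum_eq_single 0 (fun n hn ↦ by simp [hn])]
    simp
  rw [integral_Ioi_of_hasDerivAt_of_tendsto' (fun x _ ↦ hderiv x) (integrableOn_mainardi hν0 hν1)
    (tendsto_mainardiSeries_zero_atTop hν0 hν1).neg, hzero]
  norm_num

theorem greenCauchy_median (ν : ℝ) (hν0 : 1 / 2 ≤ ν) (hν1 : ν < 1)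
    (m : ℝ) (hm : 0 < m) (hmed : ∫ u in (0 : ℝ)..m, mainardi ν u = 1 / 2)
    (t : ℝ) (ht : 0 < t) :
    (∫ r in (0 : ℝ)..(m * t ^ ν), greenCauchy ν r t) = 1 / 4 ∧
    (1 / 4 : ℝ) = (1 / 2) * ∫ r in Ioi (0 : ℝ), greenCauchy ν r t := by
  have hT : 0 < t ^ ν := rpow_pos_of_pos ht ν
  have hG : ∀ r, 0 ≤ r → greenCauchy ν r t = mainardi ν (r / t ^ ν) / (2 * t ^ ν) :=
    fun r hr ↦ by rw [greenCauchy, abs_of_nonneg hr]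
  constructor
  · rw [intervalIntegral.integral_congr (g := fun r ↦ mainardi ν (r / t ^ ν) / (2 * t ^ ν))
      fun r hr ↦ hG r (by rw [uIcc_of_le (by positivity)] at hr; exact hr.1),
      intervalIntegral.integral_div, intervalIntegral.integral_comp_div _ hT.ne', zero_div,
      mul_div_cancel_right₀ _ hT.ne', hmed, smul_eq_mul]
    field_simp
    norm_num
  · rw [setIntegral_congr_fun (g := fun r ↦ mainardi ν (r * (t ^ ν)⁻¹) / (2 * t ^ ν))
      measurableSet_Ioi fun r hr ↦ hG r (le_of_lt hr),
      integral_div, integral_comp_mul_right_Ioi _ _ (inv_pos.2 hT), zero_mul,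
      integral_mainardi hν0 hν1, inv_inv, smul_eq_mul]
    field_simp
    norm_num
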